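/- Let n ≥ 1, let 𝔹 be the closed unit ball of ℝ^n and let f : 𝔹 → 𝔹 be continuous. Suppose that for some 0 < ε < 1/2 one has ‖f(x) − x‖ < ε for each x in the unit sphere ∂𝔹. Then the image f(𝔹) contains the open ball B(0, 1 − ε). -/

import Mathlib

open MeasureTheory Metric Set Filter
open scoped NNReal ENNReal Topology

noncomputable section

/-- If the integral of a family of polynomials of bounded degree is constant for small positive
values of the indeterminate, then it is constant everywhere. -/
theorem integral_eval_eq_of_forall_small {α : Type*} [MeasurableSpace α] {μ : Measure α}
    {p : α → Polynomial ℝ} {N : ℕ} (hdeg : ∀ x, (p x).natDegree ≤ N)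
    (hinteg : ∀ t, Integrable (fun x => (p x).eval t) μ) {δ c : ℝ} (hδ : 0 < δ)
    (h : ∀ t ∈ Ioo 0 δ, ∫ x, (p x).eval t ∂μ = c) (s : ℝ) :
    ∫ x, (p x).eval s ∂μ = c := by
  set v : ℕ → ℝ := fun i => δ / (i + 2) with hv
  have hinj : Function.Injective v := by
    intro i j hij
    have h1 : (0 : ℝ) < i + 2 := by positivity
    have h2 : (0 : ℝ) < j + 2 := by positivity
    simp only [hv] at hij
    rw [div_eq_div_iff h1.ne' h2.ne'] at hij
    have := mul_left_cancel₀ hδ.ne' hij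
    exact_mod_cast (add_right_cancel this).symm
  have hmem : ∀ i, v i ∈ Ioo 0 δ := by
    intro i
    refine ⟨by positivity, ?_⟩
    have h1 : (0 : ℝ) ≤ i := by positivity
    simp only [hv]
    rw [div_lt_iff₀ (by positivity)]
    nlinarith
  have hs : Set.InjOn v (Finset.range (N + 1)) := hinj.injOn
  have key : ∀ x, (p x).eval s = ∑ i ∈ Finset.range (N + 1),
      (p x).eval (v i) * (Lagrange.basis (Finset.range (N + 1)) v i).eval s := by
    intro x
    have hd : (p x).degree < (Finset.range (N + 1)).card := by
      rw [Finset.card_range]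
      exact (Polynomial.degree_le_natDegree).trans_lt
        (by exact_mod_cast Nat.lt_succ_of_le (hdeg x))
    conv_lhs => rw [Lagrange.eq_interpolate hs hd]
    simp [Lagrange.interpolate_apply, Polynomial.eval_finsetSum]
  simp_rw [key]
  rw [integral_finsetSum _ fun i _ => (hinteg (v i)).mul_const _]
  simp_rw [integral_mul_const, h _ (hmem _)]
  rw [← Finset.mul_sum, ← Polynomial.eval_finsetSum, Lagrange.sum_basis hs ⟨0, by simp⟩]
  simp

/-- The determinant of `1 + t A` is polynomial in `t`. -/
theorem LinearMap.exists_polynomial_eval_eq_det_one_add_smul {E : Type*} [AddCommGroup E]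
    [Module ℝ E] [FiniteDimensional ℝ E] (A : E →ₗ[ℝ] E) :
    ∃ p : Polynomial ℝ, p.natDegree ≤ Module.finrank ℝ E ∧
      ∀ t : ℝ, p.eval t = LinearMap.det (1 + t • A) := by
  obtain ⟨n, hn⟩ : ∃ n, n = Module.finrank ℝ E := ⟨_, rfl⟩
  let b : Module.Basis (Fin n) ℝ E := Module.finBasisOfFinrankEq ℝ E hn.symm
  rw [← hn]
  have hdet : ∀ t : ℝ, LinearMap.det (1 + t • A) =
      Matrix.det (1 + t • LinearMap.toMatrix b b A) := by
    intro t
    rw [← LinearMap.det_toMatrix b, map_add, map_smul, LinearMap.toMatrix_one]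
  generalize LinearMap.toMatrix b b A = M at hdet
  refine ⟨((Polynomial.X : Polynomial ℝ) • M.map Polynomial.C +
    (1 : Matrix (Fin n) (Fin n) ℝ).map Polynomial.C).det,
    (Polynomial.natDegree_det_X_add_C_le M 1).trans (by simp), fun t => ?_⟩
  rw [hdet, ← Polynomial.coe_evalRingHom, RingHom.map_det]
  congr 1
  ext i j
  by_cases hij : i = j
  · simp [hij, add_comm, mul_comm t]
  · simp [hij, mul_comm t]

section

variable {E : Type*} [NormedAddCommGroup E] [InnerProductSpace ℝ E]

/-- The squared norm of `v + t w` is polynomial in `t`. -/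
theorem exists_polynomial_eval_eq_pow_sub_norm_sq (C : ℝ) (v w : E) (k : ℕ) :
    ∃ p : Polynomial ℝ, p.natDegree ≤ k * 2 ∧
      ∀ t : ℝ, p.eval t = (C - ‖v + t • w‖ ^ 2) ^ k := by
  refine ⟨(Polynomial.C (C - ‖v‖ ^ 2) - Polynomial.C (2 * inner ℝ v w) * Polynomial.X -
    Polynomial.C (‖w‖ ^ 2) * Polynomial.X ^ 2) ^ k, ?_, fun t => ?_⟩
  · exact Polynomial.natDegree_pow_le_of_le k (by compute_degree)
  · simp only [Polynomial.eval_pow, Polynomial.eval_sub, Polynomial.eval_C, Polynomial.eval_mul,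
      Polynomial.eval_X]
    rw [norm_add_sq_real, inner_smul_right, norm_smul, mul_pow, Real.norm_eq_abs, sq_abs]
    ring

variable [FiniteDimensional ℝ E]

/-- A small Lipschitz perturbation of the identity is bijective. -/
theorem LipschitzWith.bijective_id_add {h : E → E} {K : ℝ≥0} (hh : LipschitzWith K h)
    (hK : K < 1) : Function.Bijective fun x => x + h x := by
  have ha : ApproximatesLinearOn (fun x => x + h x)
      ((ContinuousLinearEquiv.refl ℝ E : E ≃L[ℝ] E) : E →L[ℝ] E) univ K := by
    intro x _ y _
    have := hh.dist_le_mul x y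
    rw [dist_eq_norm, dist_eq_norm] at this
    simpa [add_sub_add_comm] using this
  have hc : Subsingleton E ∨ K <
      ‖((ContinuousLinearEquiv.refl ℝ E).symm : E →L[ℝ] E)‖₊⁻¹ := by
    rcases subsingleton_or_nontrivial E with hE | hE
    · exact Or.inl hE
    · right
      have : ‖((ContinuousLinearEquiv.refl ℝ E).symm : E →L[ℝ] E)‖₊ = 1 := by
        simp
      rw [this]; simpa using hK
  exact ⟨injOn_univ.1 (ha.injOn hc), ha.surjective hc⟩

omit [InnerProductSpace ℝ E] [FiniteDimensional ℝ E] in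
/-- A bijective perturbation of the identity supported in a ball maps this ball onto itself. -/
theorem image_closedBall_id_add_eq {h : E → E} {R : ℝ} (hR : ∀ x ∉ closedBall (0 : E) R, h x = 0)
    (hb : Function.Bijective fun x => x + h x) :
    (fun x => x + h x) '' closedBall 0 R = closedBall 0 R := by
  have hcompl : (fun x => x + h x) '' (closedBall 0 R)ᶜ = (closedBall 0 R)ᶜ := by
    have : EqOn (fun x => x + h x) id (closedBall 0 R)ᶜ := fun x hx => by simp [hR x hx]
    rw [this.image_eq, image_id]
  rw [image_compl_eq hb] at hcompl
  exact compl_injective hcompl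

variable [MeasurableSpace E] [BorelSpace E]

/-- Change of variables for a perturbation of the identity supported in a ball, not assumed to be
injective, tested against powers of `z ↦ C - ‖z - y‖ ^ 2`. -/
theorem integral_det_mul_pow_eq {h : E → E} (hd : ContDiff ℝ 1 h) (hs : HasCompactSupport h)
    {R : ℝ} (hR : ∀ x ∉ closedBall (0 : E) R, h x = 0) (y : E) (C : ℝ) (k : ℕ) :
    ∫ x in closedBall (0 : E) R,
      (1 + fderiv ℝ h x : E →L[ℝ] E).det * (C - ‖x + h x - y‖ ^ 2) ^ k =
    ∫ x in closedBall (0 : E) R, (C - ‖x - y‖ ^ 2) ^ k := by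
  have hf : Continuous (fderiv ℝ h) := hd.continuous_fderiv one_ne_zero
  have hh : Continuous h := hd.continuous
  choose p hpdeg hp using fun x =>
    LinearMap.exists_polynomial_eval_eq_det_one_add_smul (fderiv ℝ h x : E →ₗ[ℝ] E)
  choose q hqdeg hq using fun x => exists_polynomial_eval_eq_pow_sub_norm_sq C (x - y) (h x) k
  have heval : ∀ x t, (p x * q x).eval t =
      (1 + t • fderiv ℝ h x : E →L[ℝ] E).det * (C - ‖x + t • h x - y‖ ^ 2) ^ k := by
    intro x t
    rw [Polynomial.eval_mul, hp, hq, sub_add_eq_add_sub]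
    rfl
  have hinteg : ∀ t, Integrable (fun x => (p x * q x).eval t)
      (volume.restrict (closedBall (0 : E) R)) := by
    intro t
    simp_rw [heval]
    refine ContinuousOn.integrableOn_compact (isCompact_closedBall 0 R) (Continuous.continuousOn ?_)
    refine Continuous.mul (ContinuousLinearMap.continuous_det.comp ?_) ?_ <;> fun_prop
  obtain ⟨K, hK⟩ := ContDiff.lipschitzWith_of_hasCompactSupport hs hd one_ne_zero
  obtain ⟨ρ, hρ, hdet⟩ : ∃ ρ > 0, ∀ B : E →L[ℝ] E, ‖B‖ < ρ → 0 < (1 + B).det := by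
    have hc : Continuous fun B : E →L[ℝ] E => (1 + B).det :=
      ContinuousLinearMap.continuous_det.comp (by fun_prop)
    have h1 : ∀ᶠ B in 𝓝 (0 : E →L[ℝ] E), 0 < (1 + B).det := by
      refine hc.continuousAt.eventually_const_lt ?_
      simp [ContinuousLinearMap.det]
    obtain ⟨ρ, hρ, hB⟩ := Metric.eventually_nhds_iff.1 h1
    exact ⟨ρ, hρ, fun B hb => hB (by simpa using hb)⟩
  have hKpos : (0 : ℝ) < K + 1 := by positivity
  have hsmall : ∀ t ∈ Ioo 0 (min 1 ρ / (K + 1)), ∫ x in closedBall (0 : E) R, (p x * q x).eval t =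
      ∫ x in closedBall (0 : E) R, (C - ‖x - y‖ ^ 2) ^ k := by
    intro t ht
    have htK : t * K < min 1 ρ := by
      have := (lt_div_iff₀ hKpos).1 ht.2
      nlinarith [ht.1]
    have hlip : LipschitzWith (t.toNNReal * K) fun x => t • h x := by
      have := (lipschitzWith_smul t (α := ℝ) (β := E)).comp hK
      rwa [← Real.toNNReal_eq_nnnorm_of_nonneg ht.1.le] at this
    have hbij := hlip.bijective_id_add (by
      rw [← NNReal.coe_lt_coe]
      simpa [ht.1.le] using htK.trans_le (min_le_left _ _))
    have himg := image_closedBall_id_add_eq (h := fun x => t • h x) (R := R)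
      (fun x hx => by simp [hR x hx]) hbij
    have hder : ∀ x ∈ closedBall (0 : E) R, HasFDerivWithinAt (fun x => x + t • h x)
        (1 + t • fderiv ℝ h x : E →L[ℝ] E) (closedBall 0 R) x := fun x _ =>
      ((hasFDerivAt_id x).add
        (((hd.differentiable one_ne_zero x).hasFDerivAt).const_smul t)).hasFDerivWithinAt
    have hcov := integral_image_eq_integral_abs_det_fderiv_smul volume
      (measurableSet_closedBall (x := (0 : E)) (ε := R)) hder hbij.1.injOn
      (fun z => (C - ‖z - y‖ ^ 2) ^ k)
    rw [himg] at hcov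
    rw [hcov]
    refine integral_congr_ae (Eventually.of_forall fun x => ?_)
    have hpos : 0 < (1 + t • fderiv ℝ h x : E →L[ℝ] E).det := by
      refine hdet _ ?_
      rw [norm_smul, Real.norm_of_nonneg ht.1.le]
      exact (mul_le_mul_of_nonneg_left (norm_fderiv_le_of_lipschitz ℝ hK) ht.1.le).trans_lt
        (htK.trans_le (min_le_right _ _))
    simp only [heval, abs_of_pos hpos, smul_eq_mul]
  have := integral_eval_eq_of_forall_small
    (fun x => Polynomial.natDegree_mul_le_of_le (hpdeg x) (hqdeg x)) hinteg (by positivity) hsmall 1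
  simpa only [heval, one_smul] using this

omit [MeasurableSpace E] [BorelSpace E] in
/-- A continuously differentiable map which is the identity outside a compact set has dense
range. -/
theorem ContDiff.exists_norm_id_add_sub_lt {h : E → E} (hd : ContDiff ℝ 1 h)
    (hs : HasCompactSupport h) (y : E) {δ : ℝ} (hδ : 0 < δ) : ∃ x, ‖x + h x - y‖ < δ := by
  borelize E
  by_contra! hfar
  obtain ⟨R₀, hR₀⟩ := hs.isCompact.isBounded.subset_closedBall (0 : E)
  set R := max R₀ (‖y‖ + δ) with hRdef
  have hR : ∀ x ∉ closedBall (0 : E) R, h x = 0 := fun x hx => by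
    by_contra hne
    exact hx (closedBall_subset_closedBall (le_max_left _ _)
      (hR₀ (subset_tsupport h (Function.mem_support.2 hne))))
  have hcomp : IsCompact (closedBall (0 : E) R) := isCompact_closedBall 0 R
  have hh : Continuous h := hd.continuous
  have hf : Continuous (fderiv ℝ h) := hd.continuous_fderiv one_ne_zero
  have hdetc : Continuous fun x => (1 + fderiv ℝ h x : E →L[ℝ] E).det :=
    ContinuousLinearMap.continuous_det.comp (by fun_prop)
  obtain ⟨M, hM⟩ := hcomp.exists_bound_of_continuousOn hdetc.continuousOn
  obtain ⟨C₁, hC₁⟩ := hcomp.exists_bound_of_continuousOn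
    (f := fun x => ‖x + h x - y‖ ^ 2) (by fun_prop)
  obtain ⟨C₂, hC₂⟩ := hcomp.exists_bound_of_continuousOn
    (f := fun x => ‖x - y‖ ^ 2) (by fun_prop)
  set C := max (max C₁ C₂) (δ ^ 2) with hCdef
  have hb₁ : ∀ x ∈ closedBall (0 : E) R, ‖x + h x - y‖ ^ 2 ≤ C := fun x hx =>
    (le_abs_self _).trans ((hC₁ x hx).trans ((le_max_left _ _).trans (le_max_left _ _)))
  have hb₂ : ∀ x ∈ closedBall (0 : E) R, ‖x - y‖ ^ 2 ≤ C := fun x hx =>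
    (le_abs_self _).trans ((hC₂ x hx).trans ((le_max_right _ _).trans (le_max_left _ _)))
  have hCδ : δ ^ 2 ≤ C := le_max_right _ _
  set a := C - δ ^ 2 with ha
  set b := C - (δ / 2) ^ 2 with hb
  have ha0 : 0 ≤ a := sub_nonneg.2 hCδ
  have hab : a < b := by simp only [ha, hb]; nlinarith
  have hb0 : 0 < b := ha0.trans_lt hab
  have hsub : ball y (δ / 2) ⊆ closedBall (0 : E) R := fun x hx => by
    rw [mem_ball, dist_eq_norm] at hx
    rw [mem_closedBall, dist_zero_right]
    refine le_trans ?_ (le_max_right _ _)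
    have := norm_add_le (x - y) y
    rw [sub_add_cancel] at this
    linarith
  set V := volume.real (closedBall (0 : E) R) with hV
  set v := volume.real (ball y (δ / 2)) with hv
  have hv0 : 0 < v := ENNReal.toReal_pos (measure_ball_pos volume y (by positivity)).ne'
    measure_ball_lt_top.ne
  have hineq : ∀ k : ℕ, b ^ k * v ≤ M * a ^ k * V := by
    intro k
    have hlow : b ^ k * v ≤ ∫ x in closedBall (0 : E) R, (C - ‖x - y‖ ^ 2) ^ k := by
      have hinteg : IntegrableOn (fun x : E => (C - ‖x - y‖ ^ 2) ^ k) (closedBall 0 R) :=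
        ContinuousOn.integrableOn_compact hcomp (by fun_prop)
      calc b ^ k * v = ∫ _ in ball y (δ / 2), b ^ k := by
            simp [hv, mul_comm]
        _ ≤ ∫ x in ball y (δ / 2), (C - ‖x - y‖ ^ 2) ^ k := by
            refine setIntegral_mono_on (integrableOn_const measure_ball_lt_top.ne)
              (hinteg.mono_set hsub) measurableSet_ball fun x hx => ?_
            rw [mem_ball, dist_eq_norm] at hx
            exact pow_le_pow_left₀ hb0.le (by simp only [hb]; gcongr) k
        _ ≤ _ := by
            refine setIntegral_mono_set hinteg ?_ hsub.eventuallyLE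
            refine (ae_restrict_iff' measurableSet_closedBall).2 (.of_forall fun x hx => ?_)
            exact pow_nonneg (sub_nonneg.2 (hb₂ x hx)) k
    refine hlow.trans ?_
    rw [← integral_det_mul_pow_eq hd hs hR y C k]
    refine (Real.le_norm_self _).trans (norm_setIntegral_le_of_norm_le_const
      hcomp.measure_lt_top fun x hx => ?_)
    rw [norm_mul, norm_pow, Real.norm_of_nonneg (sub_nonneg.2 (hb₁ x hx))]
    have h1 : C - ‖x + h x - y‖ ^ 2 ≤ a := by
      have := hfar x
      simp only [ha]
      gcongr
    exact mul_le_mul (hM x hx) (pow_le_pow_left₀ (sub_nonneg.2 (hb₁ x hx)) h1 k)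
      (pow_nonneg (sub_nonneg.2 (hb₁ x hx)) k) ((norm_nonneg _).trans (hM x hx))
  have hlim : Tendsto (fun k : ℕ => M * V * (a / b) ^ k) atTop (𝓝 (M * V * 0)) :=
    (tendsto_pow_atTop_nhds_zero_of_lt_one (by positivity) ((div_lt_one hb0).2 hab)).const_mul _
  rw [mul_zero] at hlim
  refine absurd (ge_of_tendsto' hlim fun k => ?_) (not_le.2 hv0)
  have hk := hineq k
  rw [div_pow, mul_div_assoc', le_div_iff₀ (by positivity)]
  linarith

end

theorem stmt9 (n : ℕ) (hn : 1 ≤ n)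
    (f : EuclideanSpace ℝ (Fin n) → EuclideanSpace ℝ (Fin n))
    (hf : ContinuousOn f (closedBall 0 1))
    (hmaps : MapsTo f (closedBall 0 1) (closedBall 0 1))
    (ε : ℝ) (hε0 : 0 < ε) (hε2 : ε < 1 / 2)
    (hsphere : ∀ x ∈ sphere (0 : EuclideanSpace ℝ (Fin n)) 1, ‖f x - x‖ < ε) :
    ball (0 : EuclideanSpace ℝ (Fin n)) (1 - ε) ⊆ f '' closedBall 0 1 := by
  intro y hy
  rw [mem_ball, dist_zero_right] at hy
  by_contra hmiss
  let π : EuclideanSpace ℝ (Fin n) → EuclideanSpace ℝ (Fin n) := fun x => (max 1 ‖x‖)⁻¹ • x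
  have hmax : ∀ x : EuclideanSpace ℝ (Fin n), 0 < max 1 ‖x‖ := fun x =>
    lt_max_of_lt_left one_pos
  have hπc : Continuous π := by
    refine Continuous.smul (Continuous.inv₀ (continuous_const.max continuous_norm) fun x => ?_)
      continuous_id
    exact (hmax x).ne'
  have hπmem : ∀ x, π x ∈ closedBall 0 1 := fun x => by
    rw [mem_closedBall, dist_zero_right, norm_smul, norm_inv, Real.norm_of_nonneg (hmax x).le,
      inv_mul_le_one₀ (hmax x)]
    exact le_max_right _ _
  let lam : EuclideanSpace ℝ (Fin n) → ℝ := fun x => min 1 (max 0 (2 - ‖x‖))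
  let H : EuclideanSpace ℝ (Fin n) → EuclideanSpace ℝ (Fin n) := fun x => lam x • (f (π x) - π x)
  have hHc : Continuous H :=
    Continuous.smul (f := lam)
      (continuous_const.min (continuous_const.max (continuous_const.sub continuous_norm)))
      ((hf.comp_continuous hπc hπmem).sub hπc)
  have hHsupp : Function.support H ⊆ closedBall 0 2 := fun x hx => by
    rw [mem_closedBall, dist_zero_right]
    by_contra! hlt
    exact hx (by simp [H, lam, max_eq_left (sub_nonpos.2 hlt.le)])
  have hne : ∀ x, x + H x ≠ y := by
    intro x hxy
    rcases le_or_gt ‖x‖ 1 with hx | hx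
    · have h1 : π x = x := by simp [π, max_eq_left hx]
      have h2 : lam x = 1 := min_eq_left (le_max_of_le_right (by linarith))
      simp only [H, h1, h2, one_smul, add_sub_cancel] at hxy
      exact hmiss ⟨x, by simpa using hx, hxy⟩
    · have h1 : π x ∈ sphere (0 : EuclideanSpace ℝ (Fin n)) 1 := by
        rw [mem_sphere, dist_zero_right, norm_smul, norm_inv, Real.norm_of_nonneg (hmax x).le,
          max_eq_right hx.le, inv_mul_cancel₀ (by positivity)]
      have h2 : ‖H x‖ ≤ ε := by
        have h0 : 0 ≤ lam x := le_min zero_le_one (le_max_left _ _)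
        rw [norm_smul, Real.norm_of_nonneg h0]
        exact (mul_le_of_le_one_left (norm_nonneg _) (min_le_left _ _)).trans (hsphere _ h1).le
      have h3 := norm_sub_le (x + H x) (H x)
      rw [add_sub_cancel_right, hxy] at h3
      linarith
  obtain ⟨g, hg, hgH, hgsupp⟩ := hHc.exists_contDiff_approx 1 (ε := fun x => ‖x + H x - y‖ / 2)
    (by fun_prop) fun x => half_pos (norm_pos_iff.2 (sub_ne_zero.2 (hne x)))
  have hgc : HasCompactSupport g :=
    HasCompactSupport.of_support_subset_isCompact (isCompact_closedBall 0 2)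
      (hgsupp.trans hHsupp)
  have hpos : ∀ x, 0 < ‖x + g x - y‖ := fun x => by
    have h1 := hgH x
    rw [dist_eq_norm] at h1
    have h2 := norm_sub_le (x + g x - y) (g x - H x)
    rw [show x + g x - y - (g x - H x) = x + H x - y by abel] at h2
    linarith [norm_nonneg (g x - H x)]
  obtain ⟨x₀, -, hx₀⟩ := (isCompact_closedBall (0 : EuclideanSpace ℝ (Fin n)) 2).exists_isMinOn
    ⟨0, by simp⟩ (f := fun x => ‖x + g x - y‖) (by have := hg.continuous; fun_prop)
  obtain ⟨x, hx⟩ := hg.exists_norm_id_add_sub_lt hgc y (lt_min one_pos (hpos x₀))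
  by_cases hx2 : x ∈ closedBall 0 2
  · exact absurd (hx.trans_le (min_le_right _ _)) (not_lt.2 (hx₀ hx2))
  · have hgx : g x = 0 := by
      by_contra h0
      exact hx2 (hHsupp (hgsupp (Function.mem_support.2 h0)))
    have h1 := hx.trans_le (min_le_left _ _)
    rw [mem_closedBall, dist_zero_right, not_le] at hx2
    rw [hgx, add_zero] at h1
    linarith [norm_sub_norm_le x y]
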